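/- Let T be a tree with n vertices and maximum degree Δ, and let ρ ∈ V(T) be a vertex with deg(ρ) = Δ. If T contains an end-support vertex distinct from ρ whose degree is at least 3, then there exists a tree T' with n vertices and maximum degree Δ such that HM₁(T) > HM₁(T') and HM₂(T) > HM₂(T'). -/

import Mathlib

/-- The degree of a vertex (classical version, no decidability assumptions). -/
noncomputable def deg {V : Type*} [Fintype V] (G : SimpleGraph V) (v : V) : ℕ := by
  classical exact G.degree v

/-- The maximum degree of a graph (classical version). -/
noncomputable def maxDeg {V : Type*} [Fintype V] (G : SimpleGraph V) : ℕ := by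
  classical exact G.maxDegree

/-- The first hyper-Zagreb index `HM₁(G) = Σ_{uv ∈ E(G)} (deg u + deg v)²`. -/
noncomputable def HM1 {V : Type*} [Fintype V] (G : SimpleGraph V) : ℕ := by
  classical
  exact ∑ e ∈ G.edgeFinset,
    Sym2.lift ⟨fun u v => (G.degree u + G.degree v) ^ 2, fun u v => by ring⟩ e

/-- The second hyper-Zagreb index `HM₂(G) = Σ_{uv ∈ E(G)} (deg u · deg v)²`. -/
noncomputable def HM2 {V : Type*} [Fintype V] (G : SimpleGraph V) : ℕ := by
  classical
  exact ∑ e ∈ G.edgeFinset,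
    Sym2.lift ⟨fun u v => (G.degree u * G.degree v) ^ 2, fun u v => by ring⟩ e

/-- A support vertex: a vertex adjacent to a leaf (a vertex of degree 1). -/
def IsSupportVertex {V : Type*} [Fintype V] (G : SimpleGraph V) (v : V) : Prop :=
  ∃ u, G.Adj v u ∧ deg G u = 1

/-- An end-support vertex: a support vertex all of whose neighbors except exactly one
are leaves. -/
def IsEndSupportVertex {V : Type*} [Fintype V] (G : SimpleGraph V) (v : V) : Prop :=
  IsSupportVertex G v ∧ {u | G.Adj v u ∧ deg G u ≠ 1}.ncard = 1

open Finset

section LeafMove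

open scoped Classical

variable {V : Type*} [Fintype V]

/-- The sum of `f (deg u) (deg v)` over the edges `uv` of `G`, for a symmetric weight `f`. -/
noncomputable def edgeDegreeSum (f : ℕ → ℕ → ℕ) (hf : ∀ a b, f a b = f b a)
    (G : SimpleGraph V) : ℕ :=
  ∑ e ∈ G.edgeFinset, Sym2.lift ⟨fun u v => f (G.degree u) (G.degree v), fun _ _ => hf _ _⟩ e

/-- Detach the vertex `a` from its neighbor `v` and attach it to `b` instead. -/
def moveLeaf {W : Type*} (G : SimpleGraph W) (v a b : W) : SimpleGraph W :=
  G.deleteEdges {s(v, a)} ⊔ SimpleGraph.edge a b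

lemma sum_edgeFinset_eq_add_sum_neighborFinset (G : SimpleGraph V) (v : V) (g : Sym2 V → ℕ) :
    ∑ e ∈ G.edgeFinset, g e =
      ∑ e ∈ G.edgeFinset with v ∉ e, g e + ∑ x ∈ G.neighborFinset v, g s(v, x) := by
  rw [← Finset.sum_filter_not_add_sum_filter G.edgeFinset (v ∈ ·)]
  congr 1
  symm
  refine Finset.sum_bij (fun x _ => s(v, x)) ?_ ?_ ?_ ?_
  · intro x hx
    simpa using hx
  · intro x _ y _ h
    exact Sym2.congr_right.mp h
  · intro e he
    simp only [mem_filter, SimpleGraph.mem_edgeFinset] at he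
    obtain ⟨he, x, rfl⟩ := he
    exact ⟨x, by simpa using he, rfl⟩
  · intros
    rfl

lemma neighborFinset_eq_singleton_of_degree_eq_one {G : SimpleGraph V} {v a : V}
    (hva : G.Adj v a) (ha : G.degree a = 1) : G.neighborFinset a = {v} := by
  obtain ⟨x, hx⟩ := Finset.card_eq_one.mp ha
  have hv : v ∈ G.neighborFinset a := by simpa using hva.symm
  rw [hx, mem_singleton] at hv
  rw [hx, hv]

lemma adj_iff_eq_of_degree_eq_one {G : SimpleGraph V} {v a : V}
    (hva : G.Adj v a) (ha : G.degree a = 1) (x : V) : G.Adj a x ↔ x = v := by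
  rw [← SimpleGraph.mem_neighborFinset, neighborFinset_eq_singleton_of_degree_eq_one hva ha,
    mem_singleton]

lemma moveLeaf_adj {W : Type*} {G : SimpleGraph W} {v a b : W} (hab : a ≠ b) (x y : W) :
    (moveLeaf G v a b).Adj x y ↔
      (G.Adj x y ∧ s(x, y) ≠ s(v, a)) ∨ s(x, y) = s(a, b) := by
  simp only [moveLeaf, SimpleGraph.sup_adj, SimpleGraph.deleteEdges_adj, Set.mem_singleton_iff,
    SimpleGraph.edge_adj, Sym2.eq_iff, ne_eq]
  grind

variable {G : SimpleGraph V} {v a b : V}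

lemma moveLeaf_neighborFinset_center
    (hva : G.Adj v a) (hvb : G.Adj v b) (hab : a ≠ b) :
    (moveLeaf G v a b).neighborFinset v = (G.neighborFinset v).erase a := by
  ext x
  have h1 := hva.ne
  have h2 := hvb.ne
  simp only [SimpleGraph.mem_neighborFinset, moveLeaf_adj hab, mem_erase, Sym2.eq_iff, ne_eq]
  grind

lemma moveLeaf_degree_center
    (hva : G.Adj v a) (hvb : G.Adj v b) (hab : a ≠ b) :
    (moveLeaf G v a b).degree v = G.degree v - 1 := by
  rw [← SimpleGraph.card_neighborFinset_eq_degree,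
    moveLeaf_neighborFinset_center hva hvb hab,
    Finset.card_erase_of_mem (by simpa using hva), SimpleGraph.card_neighborFinset_eq_degree]

lemma moveLeaf_degree_moved
    (hva : G.Adj v a) (hvb : G.Adj v b) (hab : a ≠ b)
    (ha : G.degree a = 1) : (moveLeaf G v a b).degree a = 1 := by
  have h : (moveLeaf G v a b).neighborFinset a = {b} := by
    ext x
    have h1 := hva.ne
    have h2 := hvb.ne
    simp only [SimpleGraph.mem_neighborFinset, moveLeaf_adj hab, mem_singleton, Sym2.eq_iff,
      ne_eq, adj_iff_eq_of_degree_eq_one hva ha]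
    grind
  rw [← SimpleGraph.card_neighborFinset_eq_degree, h, card_singleton]

lemma moveLeaf_degree_target
    (hva : G.Adj v a) (hvb : G.Adj v b) (hab : a ≠ b)
    (hb : G.degree b = 1) : (moveLeaf G v a b).degree b = 2 := by
  have h : (moveLeaf G v a b).neighborFinset b = {v, a} := by
    ext x
    have h1 := hva.ne
    have h2 := hvb.ne
    simp only [SimpleGraph.mem_neighborFinset, moveLeaf_adj hab, mem_insert, mem_singleton,
      Sym2.eq_iff, ne_eq, adj_iff_eq_of_degree_eq_one hvb hb]
    grind
  rw [← SimpleGraph.card_neighborFinset_eq_degree, h, card_pair hva.ne]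

lemma moveLeaf_degree_of_ne (hab : a ≠ b) {x : V} (hxv : x ≠ v) (hxa : x ≠ a) (hxb : x ≠ b) :
    (moveLeaf G v a b).degree x = G.degree x := by
  have h : (moveLeaf G v a b).neighborFinset x = G.neighborFinset x := by
    ext y
    simp only [SimpleGraph.mem_neighborFinset, moveLeaf_adj hab, Sym2.eq_iff, ne_eq]
    grind
  rw [← SimpleGraph.card_neighborFinset_eq_degree, h, SimpleGraph.card_neighborFinset_eq_degree]

lemma moveLeaf_edgeFinset (hab : a ≠ b) :
    (moveLeaf G v a b).edgeFinset = insert s(a, b) (G.edgeFinset.erase s(v, a)) := by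
  ext e
  induction e with | _ x y
  simp only [SimpleGraph.mem_edgeFinset, SimpleGraph.mem_edgeSet, moveLeaf_adj hab, mem_insert,
    mem_erase]
  tauto

lemma not_adj_leaves
    (hva : G.Adj v a) (hvb : G.Adj v b) (ha : G.degree a = 1) : ¬ G.Adj a b := by
  rw [adj_iff_eq_of_degree_eq_one hva ha]
  exact hvb.ne'

lemma moveLeaf_isTree
    (hva : G.Adj v a) (hvb : G.Adj v b) (hab : a ≠ b)
    (ha : G.degree a = 1) (hG : G.IsTree) : (moveLeaf G v a b).IsTree := by
  have key : ∀ x y, G.Adj x y → (moveLeaf G v a b).Reachable x y := by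
    have hvb' : (moveLeaf G v a b).Adj v b := by
      rw [moveLeaf_adj hab]
      left
      refine ⟨hvb, ?_⟩
      have h1 := hvb.ne
      simp only [Sym2.eq_iff, ne_eq]
      grind
    have hba' : (moveLeaf G v a b).Adj b a := by
      rw [moveLeaf_adj hab]
      exact Or.inr Sym2.eq_swap
    have hva' := hvb'.reachable.trans hba'.reachable
    intro x y hxy
    by_cases h : s(x, y) = s(v, a)
    · rw [Sym2.eq_iff] at h
      rcases h with ⟨rfl, rfl⟩ | ⟨rfl, rfl⟩
      · exact hva'
      · exact hva'.symm
    · exact ((moveLeaf_adj hab x y).mpr (Or.inl ⟨hxy, h⟩)).reachable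
  have hconn : (moveLeaf G v a b).Connected := by
    have := hG.connected.nonempty
    refine ⟨fun x y => ?_⟩
    obtain ⟨p⟩ := hG.connected.preconnected x y
    induction p with
    | nil => exact SimpleGraph.Reachable.refl _
    | cons h _ ih => exact (key _ _ h).trans ih
  rw [SimpleGraph.isTree_iff_connected_and_card]
  refine ⟨hconn, ?_⟩
  have hcard := (SimpleGraph.isTree_iff_connected_and_card.mp hG).2
  rw [← hcard]
  simp only [Nat.card_eq_fintype_card, ← SimpleGraph.edgeFinset_card]
  have hmem : s(v, a) ∈ G.edgeFinset := by simpa using hva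
  have hpos := Finset.card_pos.mpr ⟨_, hmem⟩
  rw [moveLeaf_edgeFinset hab, Finset.card_insert_of_notMem,
    Finset.card_erase_of_mem hmem]
  · omega
  · have := not_adj_leaves hva hvb ha
    simp [this]

lemma moveLeaf_maxDegree
    (hva : G.Adj v a) (hvb : G.Adj v b) (hab : a ≠ b)
    (ha : G.degree a = 1) (hb : G.degree b = 1)
    {ρ : V} (hρ : G.degree ρ = G.maxDegree) (hvρ : v ≠ ρ)
    (hv : 3 ≤ G.degree v) : (moveLeaf G v a b).maxDegree = G.maxDegree := by
  have h3 : 3 ≤ G.maxDegree := hv.trans (G.degree_le_maxDegree v)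
  apply le_antisymm
  · apply SimpleGraph.maxDegree_le_of_forall_degree_le
    intro x
    have hx := G.degree_le_maxDegree x
    by_cases hxv : x = v
    · subst hxv
      rw [moveLeaf_degree_center hva hvb hab]
      omega
    by_cases hxa : x = a
    · subst hxa
      rw [moveLeaf_degree_moved hva hvb hab ha]
      omega
    by_cases hxb : x = b
    · subst hxb
      rw [moveLeaf_degree_target hva hvb hab hb]
      omega
    rw [moveLeaf_degree_of_ne hab hxv hxa hxb]
    exact hx
  · have hρa : ρ ≠ a := by rintro rfl; omega
    have hρb : ρ ≠ b := by rintro rfl; omega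
    rw [← hρ, ← moveLeaf_degree_of_ne hab hvρ.symm hρa hρb]
    exact SimpleGraph.degree_le_maxDegree _ _

lemma sum_neighborFinset_eq_add_sum_erase
    (hva : G.Adj v a) (hvb : G.Adj v b) (hab : a ≠ b) (g : V → ℕ) :
    ∑ x ∈ G.neighborFinset v, g x =
      g a + (g b + ∑ x ∈ ((G.neighborFinset v).erase a).erase b, g x) := by
  rw [Finset.add_sum_erase _ _ (by simpa [hab.symm] using hvb),
    Finset.add_sum_erase _ _ (by simpa using hva)]

/-- Edge sums before and after moving a leaf agree up to the edges incident to `v` and the new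
edge. -/
lemma exists_edgeDegreeSum_moveLeaf
    (hva : G.Adj v a) (hvb : G.Adj v b) (hab : a ≠ b)
    (ha : G.degree a = 1) (hb : G.degree b = 1) (f : ℕ → ℕ → ℕ) (hf : ∀ x y, f x y = f y x) :
    ∃ R, edgeDegreeSum f hf G = R + (f (G.degree v) 1 + (f (G.degree v) 1 +
        ∑ x ∈ ((G.neighborFinset v).erase a).erase b, f (G.degree v) (G.degree x))) ∧
      edgeDegreeSum f hf (moveLeaf G v a b) = R + (f 1 2 + (f (G.degree v - 1) 2 +
        ∑ x ∈ ((G.neighborFinset v).erase a).erase b, f (G.degree v - 1) (G.degree x))) := by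
  refine ⟨∑ e ∈ G.edgeFinset with v ∉ e,
    Sym2.lift ⟨fun u v => f (G.degree u) (G.degree v), fun _ _ => hf _ _⟩ e, ?_, ?_⟩
  · rw [edgeDegreeSum, sum_edgeFinset_eq_add_sum_neighborFinset G v,
      sum_neighborFinset_eq_add_sum_erase hva hvb hab]
    simp only [Sym2.lift_mk, ha, hb]
  · have hnot : s(a, b) ∉ G.edgeFinset.filter (v ∉ ·) := by
      simp [not_adj_leaves hva hvb ha]
    have hedges : (moveLeaf G v a b).edgeFinset.filter (v ∉ ·) =
        insert s(a, b) (G.edgeFinset.filter (v ∉ ·)) := by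
      have h1 := hva.ne
      have h2 := hvb.ne
      ext e
      rw [moveLeaf_edgeFinset hab]
      simp only [mem_filter, mem_insert, mem_erase]
      constructor
      · tauto
      · rintro (rfl | ⟨he, hve⟩)
        · simp [h1, h2]
        · refine ⟨Or.inr ⟨?_, he⟩, hve⟩
          rintro rfl
          simp at hve
    rw [edgeDegreeSum, sum_edgeFinset_eq_add_sum_neighborFinset _ v, hedges,
      Finset.sum_insert hnot, moveLeaf_neighborFinset_center hva hvb hab,
      ← Finset.add_sum_erase _ _ (show b ∈ (G.neighborFinset v).erase a by
        simpa [hab.symm] using hvb)]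
    simp only [Sym2.lift_mk, moveLeaf_degree_center hva hvb hab,
      moveLeaf_degree_moved hva hvb hab ha, moveLeaf_degree_target hva hvb hab hb]
    have hrest : ∑ x ∈ ((G.neighborFinset v).erase a).erase b,
        f (G.degree v - 1) ((moveLeaf G v a b).degree x) =
        ∑ x ∈ ((G.neighborFinset v).erase a).erase b, f (G.degree v - 1) (G.degree x) := by
      refine Finset.sum_congr rfl fun x hx => ?_
      simp only [mem_erase, SimpleGraph.mem_neighborFinset] at hx
      rw [moveLeaf_degree_of_ne hab hx.2.2.ne' hx.2.1 hx.1]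
    have hR : ∑ e ∈ G.edgeFinset with v ∉ e, Sym2.lift ⟨fun u w =>
          f ((moveLeaf G v a b).degree u) ((moveLeaf G v a b).degree w), fun _ _ => hf _ _⟩ e =
        ∑ e ∈ G.edgeFinset with v ∉ e,
          Sym2.lift ⟨fun u v => f (G.degree u) (G.degree v), fun _ _ => hf _ _⟩ e := by
      refine Finset.sum_congr rfl fun e he => ?_
      induction e with | _ x y
      simp only [mem_filter, SimpleGraph.mem_edgeFinset, SimpleGraph.mem_edgeSet,
        Sym2.mem_iff, not_or] at he
      obtain ⟨hxy, hvx, hvy⟩ := he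
      have leaf_a := adj_iff_eq_of_degree_eq_one hva ha
      have leaf_b := adj_iff_eq_of_degree_eq_one hvb hb
      have hyx := hxy.symm
      simp only [Sym2.lift_mk]
      rw [moveLeaf_degree_of_ne hab (x := x) (by grind) (by grind) (by grind),
        moveLeaf_degree_of_ne hab (x := y) (by grind) (by grind) (by grind)]
    rw [hrest, hR]
    ring

lemma HM1_moveLeaf_lt
    (hva : G.Adj v a) (hvb : G.Adj v b) (hab : a ≠ b)
    (ha : G.degree a = 1) (hb : G.degree b = 1) (hv : 3 ≤ G.degree v) :
    HM1 (moveLeaf G v a b) < HM1 G := by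
  obtain ⟨R, h, h'⟩ := exists_edgeDegreeSum_moveLeaf hva hvb hab ha hb
    (fun x y => (x + y) ^ 2) (fun x y => by ring)
  change edgeDegreeSum (fun x y => (x + y) ^ 2) (fun x y => by ring) (moveLeaf G v a b) <
    edgeDegreeSum (fun x y => (x + y) ^ 2) (fun x y => by ring) G
  rw [h, h']
  obtain ⟨d, hd⟩ := Nat.exists_eq_add_of_le' hv
  have hsum : ∑ x ∈ ((G.neighborFinset v).erase a).erase b, (d + 2 + G.degree x) ^ 2 ≤
      ∑ x ∈ ((G.neighborFinset v).erase a).erase b, (d + 3 + G.degree x) ^ 2 :=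
    Finset.sum_le_sum fun x _ => by gcongr; omega
  simp only [hd, show d + 3 - 1 = d + 2 by omega]
  nlinarith

lemma HM2_moveLeaf_lt
    (hva : G.Adj v a) (hvb : G.Adj v b) (hab : a ≠ b)
    (ha : G.degree a = 1) (hb : G.degree b = 1) (hv : 3 ≤ G.degree v) :
    HM2 (moveLeaf G v a b) < HM2 G := by
  obtain ⟨R, h, h'⟩ := exists_edgeDegreeSum_moveLeaf hva hvb hab ha hb
    (fun x y => (x * y) ^ 2) (fun x y => by ring)
  change edgeDegreeSum (fun x y => (x * y) ^ 2) (fun x y => by ring) (moveLeaf G v a b) <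
    edgeDegreeSum (fun x y => (x * y) ^ 2) (fun x y => by ring) G
  rw [h, h']
  obtain ⟨d, hd⟩ := Nat.exists_eq_add_of_le' hv
  have hcard : #(((G.neighborFinset v).erase a).erase b) = d + 1 := by
    rw [Finset.card_erase_of_mem (by simpa [hab.symm] using hvb),
      Finset.card_erase_of_mem (by simpa using hva), SimpleGraph.card_neighborFinset_eq_degree, hd]
    omega
  have hsum : ∑ x ∈ ((G.neighborFinset v).erase a).erase b,
        (((d + 2) * G.degree x) ^ 2 + (2 * d + 5)) ≤
      ∑ x ∈ ((G.neighborFinset v).erase a).erase b, ((d + 3) * G.degree x) ^ 2 := by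
    refine Finset.sum_le_sum fun x hx => ?_
    simp only [mem_erase, SimpleGraph.mem_neighborFinset] at hx
    have hpos : 1 ≤ G.degree x := (G.degree_pos_iff_exists_adj x).mpr ⟨v, hx.2.2.symm⟩
    have hsq : 1 ≤ G.degree x ^ 2 := Nat.one_le_pow _ _ hpos
    nlinarith [Nat.mul_le_mul_left (2 * d + 5) hsq]
  rw [Finset.sum_add_distrib, Finset.sum_const, hcard, smul_eq_mul] at hsum
  simp only [hd, show d + 3 - 1 = d + 2 by omega]
  nlinarith

/-- An end-support vertex of degree at least three has two distinct leaf neighbors. -/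
lemma IsEndSupportVertex.exists_two_leaves {G : SimpleGraph V} {v : V}
    (hv : IsEndSupportVertex G v) (hv3 : 3 ≤ G.degree v) :
    ∃ a b, G.Adj v a ∧ G.Adj v b ∧ a ≠ b ∧ G.degree a = 1 ∧ G.degree b = 1 := by
  obtain ⟨w, hw⟩ := Set.ncard_eq_one.mp hv.2
  have hcard : 1 < #((G.neighborFinset v).erase w) := by
    have := Finset.pred_card_le_card_erase (s := G.neighborFinset v) (a := w)
    rw [SimpleGraph.card_neighborFinset_eq_degree] at this
    omega
  have leaf : ∀ x ∈ (G.neighborFinset v).erase w, G.Adj v x ∧ G.degree x = 1 := by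
    intro x hx
    simp only [mem_erase, SimpleGraph.mem_neighborFinset] at hx
    refine ⟨hx.2, ?_⟩
    by_contra hne
    have hxw : x ∈ {u | G.Adj v u ∧ deg G u ≠ 1} := ⟨hx.2, hne⟩
    rw [hw] at hxw
    exact hx.1 hxw
  obtain ⟨a, ha, b, hb, hab⟩ := Finset.one_lt_card.mp hcard
  exact ⟨a, b, (leaf a ha).1, (leaf b hb).1, hab, (leaf a ha).2, (leaf b hb).2⟩

/-- Moving one leaf of an end-support vertex onto another of its leaves keeps the number of
vertices and the maximum degree of a tree, and lowers both hyper-Zagreb indices. -/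
lemma exists_isTree_HM_lt {G : SimpleGraph V} (hG : G.IsTree) {ρ v : V}
    (hρ : deg G ρ = maxDeg G) (hvρ : v ≠ ρ) (hv : IsEndSupportVertex G v) (hv3 : 3 ≤ deg G v) :
    ∃ G' : SimpleGraph V, G'.IsTree ∧ maxDeg G' = maxDeg G ∧ HM1 G' < HM1 G ∧ HM2 G' < HM2 G := by
  obtain ⟨a, b, hva, hvb, hab, ha, hb⟩ := hv.exists_two_leaves hv3
  exact ⟨moveLeaf G v a b, moveLeaf_isTree hva hvb hab ha hG,
    moveLeaf_maxDegree hva hvb hab ha hb hρ hvρ hv3,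
    HM1_moveLeaf_lt hva hvb hab ha hb hv3, HM2_moveLeaf_lt hva hvb hab ha hb hv3⟩

end LeafMove

theorem stmt3 (n Δ : ℕ) (T : SimpleGraph (Fin n)) (hT : T.IsTree) (hΔ : maxDeg T = Δ)
    (ρ : Fin n) (hρ : deg T ρ = Δ)
    (v : Fin n) (hvρ : v ≠ ρ) (hv : IsEndSupportVertex T v) (hv3 : 3 ≤ deg T v) :
    ∃ T' : SimpleGraph (Fin n), T'.IsTree ∧ maxDeg T' = Δ ∧
      HM1 T' < HM1 T ∧ HM2 T' < HM2 T := by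
  subst hΔ
  exact exists_isTree_HM_lt hT hρ hvρ hv hv3
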